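/- arXiv:2304.14287 — 2 statements merged into one kernel-verified Lean document; each statement's English description precedes it below -/
import Mathlib

section
/- Let k be a natural number, let α < β be real numbers, and set b(x) = (x − α)(β − x). Let q be a real polynomial such that ∫_α^β q(x)·p(x) dx = 0 for every real polynomial p of degree ≤ k. Then for every real polynomial r of degree ≤ k one has ∫_α^β ((q'·b)')(x) · r(x) dx = 0. (This is the orthogonality step in the unisolvency proof: after double integration by parts, (b·r')' has degree ≤ k, so it pairs to zero with q.) -/
open Polynomial intervalIntegral

theorem Polynomial.intervalIntegral_derivative (p : Polynomial ℝ) (a b : ℝ) :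
    ∫ x in a..b, (derivative p).eval x = p.eval b - p.eval a :=
  integral_eq_sub_of_hasDerivAt (fun x _ => p.hasDerivAt x)
    ((derivative p).continuous.intervalIntegrable a b)

theorem Polynomial.natDegree_derivative_mul_derivative_le {R : Type*} [CommSemiring R]
    {b : Polynomial R} (hb : b.natDegree ≤ 2) (r : Polynomial R) :
    (derivative (b * derivative r)).natDegree ≤ r.natDegree := by
  rcases Nat.eq_zero_or_pos r.natDegree with h | h
  · simp [derivative_of_natDegree_zero h]
  · have h₁ := natDegree_derivative_le (b * derivative r)
    have h₂ := natDegree_mul_le (p := b) (q := derivative r)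
    have h₃ := natDegree_derivative_le r
    lia

/-- Orthogonality step: if `q` is `L²(α,β)`-orthogonal to all polynomials of
degree `≤ k`, then `(q'·b)'` (with the quadratic bubble `b(x) = (x-α)(β-x)`)
is also orthogonal to all polynomials of degree `≤ k`. -/
theorem bubble_orthogonality
    (k : ℕ) (α β : ℝ) (hαβ : α < β)
    (b : Polynomial ℝ) (hb : b = (X - C α) * (C β - X))
    (q : Polynomial ℝ)
    (hq : ∀ p : Polynomial ℝ, p.natDegree ≤ k →
      ∫ x in α..β, q.eval x * p.eval x = 0) :
    ∀ r : Polynomial ℝ, r.natDegree ≤ k →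
      ∫ x in α..β, (derivative (derivative q * b)).eval x * r.eval x = 0 := by
  intro r hr
  have hdeg : b.natDegree ≤ 2 := by rw [hb]; compute_degree
  have hα : b.eval α = 0 := by simp [hb]
  have hβ : b.eval β = 0 := by simp [hb]
  have green : ∀ x, (derivative (derivative q * b)).eval x * r.eval x =
      q.eval x * (derivative (b * derivative r)).eval x +
        (derivative (b * (derivative q * r - q * derivative r))).eval x := by
    intro x
    simp only [derivative_mul, derivative_sub, eval_add, eval_sub, eval_mul]
    ring
  simp_rw [green]
  rw [integral_add (Continuous.intervalIntegrable ?_ α β) (Continuous.intervalIntegrable ?_ α β),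
    hq _ ((natDegree_derivative_mul_derivative_le hdeg r).trans hr),
    Polynomial.intervalIntegral_derivative]
  · simp [hα, hβ]
  all_goals fun_prop
end

section
/- Let k ≥ 1 be a natural number, let α < β be real numbers, and set b(x) = (x − α)(β − x). Let τ₀ be a real polynomial of degree ≤ k, and let q be a real polynomial of degree ≤ k + 1 such that ∫_α^β q(x)·p(x) dx = 0 for every real polynomial p of degree ≤ k. If ∫_α^β ( τ₀(x) + ((q'·b)')(x) ) · p(x) dx = 0 for every real polynomial p of degree ≤ k + 1, then τ₀ = 0 and q = 0. (This is the one-dimensional core of the unisolvency proof for the edge-bubble enriched H(curl) finite element: testing with p = τ₀ − q and using integration by parts yields ∫_α^β τ₀(x)² dx + ∫_α^β (q'(x))² b(x) dx = 0, which forces both contributions to vanish.) -/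
open Polynomial intervalIntegral

theorem Polynomial.eq_zero_of_eval_eq_zero_on_Ioo {p : ℝ[X]} {a b : ℝ} (hab : a < b)
    (h : ∀ x ∈ Set.Ioo a b, p.eval x = 0) : p = 0 :=
  p.eq_zero_of_infinite_isRoot ((Set.Ioo_infinite hab).mono h)

theorem Polynomial.intervalIntegrable_eval (p : ℝ[X]) (a b : ℝ) :
    IntervalIntegrable (fun x => p.eval x) MeasureTheory.volume a b :=
  p.continuous.intervalIntegrable a b

theorem Polynomial.integral_eval_derivative (p : ℝ[X]) (a b : ℝ) :
    ∫ x in a..b, (derivative p).eval x = p.eval b - p.eval a :=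
  integral_eq_sub_of_hasDerivAt (fun x _ => p.hasDerivAt x)
    ((derivative p).intervalIntegrable_eval a b)

theorem Polynomial.integral_eval_add (p r : ℝ[X]) (a b : ℝ) :
    ∫ x in a..b, (p + r).eval x = (∫ x in a..b, p.eval x) + ∫ x in a..b, r.eval x := by
  simp only [eval_add]
  exact integral_add (p.intervalIntegrable_eval a b) (r.intervalIntegrable_eval a b)

theorem Polynomial.eval_eq_zero_of_nonneg_of_integral_eq_zero {p : ℝ[X]} {a b : ℝ} (hab : a < b)
    (hp : ∀ x ∈ Set.Icc a b, 0 ≤ p.eval x) (hint : ∫ x in a..b, p.eval x = 0)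
    {x : ℝ} (hx : x ∈ Set.Icc a b) : p.eval x = 0 := by
  by_contra hne
  exact (integral_pos hab p.continuous.continuousOn
    (fun y hy => hp y (Set.Ioc_subset_Icc_self hy))
    ⟨x, hx, lt_of_le_of_ne (hp x hx) (Ne.symm hne)⟩).ne' hint

/-- One-dimensional core of the unisolvency proof for the edge-bubble
enriched `H(curl)` element: if all the edge degrees of freedom of
`τ₀ + (q'·b)'` vanish, then `τ₀ = 0` and `q = 0`. -/
theorem edge_unisolvency_core
    (k : ℕ) (hk : 1 ≤ k) (α β : ℝ) (hαβ : α < β)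
    (b : Polynomial ℝ) (hb : b = (X - C α) * (C β - X))
    (τ₀ : Polynomial ℝ) (hτ₀ : τ₀.natDegree ≤ k)
    (q : Polynomial ℝ) (hqdeg : q.natDegree ≤ k + 1)
    (hqorth : ∀ p : Polynomial ℝ, p.natDegree ≤ k →
      ∫ x in α..β, q.eval x * p.eval x = 0)
    (hdof : ∀ p : Polynomial ℝ, p.natDegree ≤ k + 1 →
      ∫ x in α..β,
        (τ₀.eval x + (derivative (derivative q * b)).eval x) * p.eval x = 0) :
    τ₀ = 0 ∧ q = 0 := by
  have hbα : b.eval α = 0 := by simp [hb]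
  have hbβ : b.eval β = 0 := by simp [hb]
  have hbpos : ∀ x ∈ Set.Ioo α β, 0 < b.eval x := fun x hx => by
    simpa [hb] using mul_pos (sub_pos.2 hx.1) (sub_pos.2 hx.2)
  have hbnonneg : ∀ x ∈ Set.Icc α β, 0 ≤ b.eval x := fun x hx => by
    simpa [hb] using mul_nonneg (sub_nonneg.2 hx.1) (sub_nonneg.2 hx.2)
  have hbdeg : b.natDegree ≤ 2 := by rw [hb]; compute_degree
  have hdeg : (derivative (b * derivative τ₀)).natDegree ≤ k := by
    have h₁ := natDegree_derivative_le (b * derivative τ₀)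
    have h₂ := natDegree_mul_le (p := b) (q := derivative τ₀)
    have h₃ := natDegree_derivative_le τ₀
    omega
  have htest := hdof (τ₀ - q) ((natDegree_sub_le _ _).trans (by omega))
  have horth := hqorth (τ₀ - derivative (b * derivative τ₀))
    ((natDegree_sub_le _ _).trans (by omega))
  have hbdry := integral_eval_derivative
    (b * (derivative q * q - derivative q * τ₀ + q * derivative τ₀)) α β
  simp only [eval_mul, hbα, hbβ, zero_mul, sub_zero] at hbdry
  simp only [← eval_mul, ← eval_add] at htest horth
  -- Integration by parts, as a polynomial identity with an exact derivative.
  have hid : τ₀ ^ 2 + derivative q ^ 2 * b =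
      (τ₀ + derivative (derivative q * b)) * (τ₀ - q)
        + q * (τ₀ - derivative (b * derivative τ₀))
        + derivative (b * (derivative q * q - derivative q * τ₀ + q * derivative τ₀)) := by
    simp only [derivative_mul, derivative_add, derivative_sub]
    ring
  have henergy : ∫ x in α..β, (τ₀ ^ 2 + derivative q ^ 2 * b).eval x = 0 := by
    rw [hid, integral_eval_add, integral_eval_add, htest, horth, hbdry, add_zero, add_zero]
  have hzero : ∀ x ∈ Set.Icc α β, (τ₀.eval x) ^ 2 + ((derivative q).eval x) ^ 2 * b.eval x = 0 := by
    intro x hx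
    simpa using eval_eq_zero_of_nonneg_of_integral_eq_zero hαβ (fun y hy => by
      have := hbnonneg y hy
      simp only [eval_add, eval_mul, eval_pow]
      positivity) henergy hx
  have hτ : τ₀ = 0 := eq_zero_of_eval_eq_zero_on_Ioo hαβ fun x hx => by
    have := hzero x (Set.Ioo_subset_Icc_self hx)
    have := mul_nonneg (sq_nonneg ((derivative q).eval x)) (hbpos x hx).le
    exact pow_eq_zero_iff two_ne_zero |>.1 (by nlinarith [sq_nonneg (τ₀.eval x)])
  have hq' : derivative q = 0 := eq_zero_of_eval_eq_zero_on_Ioo hαβ fun x hx => by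
    have := hzero x (Set.Ioo_subset_Icc_self hx)
    simpa [hτ, (hbpos x hx).ne'] using this
  have hqsq := hqorth q (by rw [derivative_eq_zero.1 hq']; omega)
  simp only [← eval_mul] at hqsq
  refine ⟨hτ, eq_zero_of_eval_eq_zero_on_Ioo hαβ fun x hx => ?_⟩
  simpa using eval_eq_zero_of_nonneg_of_integral_eq_zero hαβ
    (fun y _ => by simpa using mul_self_nonneg (q.eval y)) hqsq (Set.Ioo_subset_Icc_self hx)
end
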